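/- arXiv:1601.05190 — 4 statements merged into one kernel-verified Lean document; each statement's English description precedes it below -/
import Mathlib

section
/- Let G be a finite simple undirected connected graph on n ≥ 1 vertices. Then G is regular if and only if its δ-sequence is symmetric, i.e., if and only if δ(i) + δ(n−i+1) = δ(1) + δ(n) for every i ∈ {1, …, n}. -/
variable {V : Type*} [Fintype V] [DecidableEq V]

/-- `eCount G S` is the number of edges of `G` with both endpoints in `S`. -/
def eCount (G : SimpleGraph V) [DecidableRel G.Adj] (S : Finset V) : ℕ :=
  (G.edgeFinset.filter fun e => ∀ v ∈ e, v ∈ S).card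

/-- `vcCount G S` is the number of edges of `G` with at least one endpoint in `S`. -/
def vcCount (G : SimpleGraph V) [DecidableRel G.Adj] (S : Finset V) : ℕ :=
  (G.edgeFinset.filter fun e => ∃ v ∈ e, v ∈ S).card

/-- `cCount G S` is the number of edges of `G` with exactly one endpoint in `S`. -/
def cCount (G : SimpleGraph V) [DecidableRel G.Adj] (S : Finset V) : ℕ :=
  (G.edgeFinset.filter fun e => (∃ v ∈ e, v ∈ S) ∧ ∃ v ∈ e, v ∉ S).card

/-- Maximum of `f S` over all vertex subsets `S` of cardinality `i`. -/
noncomputable def maxOver (f : Finset V → ℕ) (i : ℕ) : ℕ :=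
  sSup {k | ∃ S : Finset V, S.card = i ∧ f S = k}

/-- Minimum of `f S` over all vertex subsets `S` of cardinality `i`. -/
noncomputable def minOver (f : Finset V → ℕ) (i : ℕ) : ℕ :=
  sInf {k | ∃ S : Finset V, S.card = i ∧ f S = k}

/-- `Δ(i)`: maximum number of edges induced by `i` vertices. -/
noncomputable def DeltaMax (G : SimpleGraph V) [DecidableRel G.Adj] (i : ℕ) : ℕ :=
  maxOver (eCount G) i

/-- `Σ(i)`: minimum number of edges induced by `i` vertices. -/
noncomputable def SigmaMin (G : SimpleGraph V) [DecidableRel G.Adj] (i : ℕ) : ℕ :=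
  minOver (eCount G) i

/-- `T(i)`: maximum number of edges touched by `i` vertices. -/
noncomputable def Tmax (G : SimpleGraph V) [DecidableRel G.Adj] (i : ℕ) : ℕ :=
  maxOver (vcCount G) i

/-- `Υ(i)`: minimum number of edges touched by `i` vertices. -/
noncomputable def UpsilonMin (G : SimpleGraph V) [DecidableRel G.Adj] (i : ℕ) : ℕ :=
  minOver (vcCount G) i

/-- `Θ(i)`: maximum number of edges cut by an `(i, n-i)` bipartition. -/
noncomputable def ThetaMax (G : SimpleGraph V) [DecidableRel G.Adj] (i : ℕ) : ℕ :=
  maxOver (cCount G) i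

/-- `Φ(i)`: minimum number of edges cut by an `(i, n-i)` bipartition. -/
noncomputable def PhiMin (G : SimpleGraph V) [DecidableRel G.Adj] (i : ℕ) : ℕ :=
  minOver (cCount G) i

/-- `δ(i) = Δ(i) - Δ(i-1)` as an integer. -/
noncomputable def deltaSeq (G : SimpleGraph V) [DecidableRel G.Adj] (i : ℕ) : ℤ :=
  (DeltaMax G i : ℤ) - (DeltaMax G (i - 1) : ℤ)

/-- `σ(i) = Σ(i) - Σ(i-1)` as an integer. -/
noncomputable def sigmaSeq (G : SimpleGraph V) [DecidableRel G.Adj] (i : ℕ) : ℤ :=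
  (SigmaMin G i : ℤ) - (SigmaMin G (i - 1) : ℤ)

/-- `τ(i) = T(i) - T(i-1)` as an integer. -/
noncomputable def tauSeq (G : SimpleGraph V) [DecidableRel G.Adj] (i : ℕ) : ℤ :=
  (Tmax G i : ℤ) - (Tmax G (i - 1) : ℤ)

/-- `υ(i) = Υ(i) - Υ(i-1)` as an integer. -/
noncomputable def upsilonSeq (G : SimpleGraph V) [DecidableRel G.Adj] (i : ℕ) : ℤ :=
  (UpsilonMin G i : ℤ) - (UpsilonMin G (i - 1) : ℤ)

/-- `θ(i) = Θ(i) - Θ(i-1)` as an integer. -/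
noncomputable def thetaSeq (G : SimpleGraph V) [DecidableRel G.Adj] (i : ℕ) : ℤ :=
  (ThetaMax G i : ℤ) - (ThetaMax G (i - 1) : ℤ)

/-- `φ(i) = Φ(i) - Φ(i-1)` as an integer. -/
noncomputable def phiSeq (G : SimpleGraph V) [DecidableRel G.Adj] (i : ℕ) : ℤ :=
  (PhiMin G i : ℤ) - (PhiMin G (i - 1) : ℤ)

theorem exists_eCount_eq_DeltaMax (G : SimpleGraph V) [DecidableRel G.Adj] {i : ℕ}
    (hi : i ≤ Fintype.card V) : ∃ S : Finset V, S.card = i ∧ eCount G S = DeltaMax G i := by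
  obtain ⟨S, -, hS⟩ := Finset.exists_subset_card_eq (s := (Finset.univ : Finset V))
    (n := i) (by simpa using hi)
  refine Nat.sSup_mem (s := {k | ∃ S : Finset V, S.card = i ∧ eCount G S = k}) ⟨_, S, hS, rfl⟩
    ⟨G.edgeFinset.card, ?_⟩
  rintro k ⟨T, -, rfl⟩
  exact Finset.card_filter_le _ _

theorem eCount_le_DeltaMax (G : SimpleGraph V) [DecidableRel G.Adj] (S : Finset V) :
    eCount G S ≤ DeltaMax G S.card := by
  refine le_csSup ⟨G.edgeFinset.card, ?_⟩ ⟨S, rfl, rfl⟩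
  rintro k ⟨T, -, rfl⟩
  exact Finset.card_filter_le _ _

theorem eCount_eq_zero_of_card_le_one (G : SimpleGraph V) [DecidableRel G.Adj] {S : Finset V}
    (hS : S.card ≤ 1) : eCount G S = 0 := by
  rw [eCount, Finset.card_eq_zero, Finset.filter_eq_empty_iff]
  intro e
  induction e with
  | _ a b =>
    intro he h
    rw [SimpleGraph.mem_edgeFinset, SimpleGraph.mem_edgeSet] at he
    exact he.ne (Finset.card_le_one.mp hS a (h a (by simp)) b (h b (by simp)))

theorem eCount_univ (G : SimpleGraph V) [DecidableRel G.Adj] :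
    eCount G Finset.univ = G.edgeFinset.card := by
  simp [eCount]

theorem eCount_compl_add_sum_degree (G : SimpleGraph V) [DecidableRel G.Adj] (S : Finset V) :
    eCount G Sᶜ + ∑ v ∈ S, G.degree v = G.edgeFinset.card + eCount G S := by
  have hdeg : ∑ v ∈ S, G.degree v = ∑ e ∈ G.edgeFinset, (S.filter (· ∈ e)).card := by
    simp_rw [← SimpleGraph.card_incidenceFinset_eq_degree,
      SimpleGraph.incidenceFinset_eq_filter]
    exact Finset.sum_card_bipartiteAbove_eq_sum_card_bipartiteBelow (fun v e => v ∈ e)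
  rw [hdeg, eCount, eCount, Finset.card_filter, Finset.card_filter, Finset.card_eq_sum_ones,
    ← Finset.sum_add_distrib, ← Finset.sum_add_distrib]
  refine Finset.sum_congr rfl fun e he => ?_
  induction e with
  | _ a b =>
    rw [SimpleGraph.mem_edgeFinset, SimpleGraph.mem_edgeSet] at he
    have hab : ({a, b} : Finset V).filter (· ∈ S) = S.filter (· ∈ s(a, b)) := by
      ext v; simp [and_comm]
    rw [← hab]
    have hne := he.ne
    by_cases ha : a ∈ S <;> by_cases hb : b ∈ S <;>
      simp [Finset.filter_insert, Finset.filter_singleton, ha, hb, hne]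

theorem DeltaMax_of_le_one (G : SimpleGraph V) [DecidableRel G.Adj] {i : ℕ}
    (hi : i ≤ Fintype.card V) (h1 : i ≤ 1) : DeltaMax G i = 0 := by
  obtain ⟨S, hS, h⟩ := exists_eCount_eq_DeltaMax G hi
  rw [← h, eCount_eq_zero_of_card_le_one G (hS.trans_le h1)]

theorem DeltaMax_card (G : SimpleGraph V) [DecidableRel G.Adj] :
    DeltaMax G (Fintype.card V) = G.edgeFinset.card := by
  obtain ⟨S, hS, h⟩ := exists_eCount_eq_DeltaMax G le_rfl
  rw [← h, (Finset.card_eq_iff_eq_univ S).mp hS, eCount_univ]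

theorem DeltaMax_sub_add_mul (G : SimpleGraph V) [DecidableRel G.Adj] {d i : ℕ}
    (hd : G.IsRegularOfDegree d) (hi : i ≤ Fintype.card V) :
    DeltaMax G (Fintype.card V - i) + i * d = G.edgeFinset.card + DeltaMax G i := by
  have hcompl (S : Finset V) :
      eCount G Sᶜ + S.card * d = G.edgeFinset.card + eCount G S := by
    simpa [hd.degree_eq] using eCount_compl_add_sum_degree G S
  apply le_antisymm
  · obtain ⟨T, hT, h⟩ := exists_eCount_eq_DeltaMax G (Nat.sub_le (Fintype.card V) i)
    have hc : Tᶜ.card = i := by rw [Finset.card_compl]; omega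
    have h1 := hcompl Tᶜ
    have h2 := eCount_le_DeltaMax G Tᶜ
    rw [compl_compl, hc] at h1
    rw [hc] at h2
    omega
  · obtain ⟨S, hS, h⟩ := exists_eCount_eq_DeltaMax G hi
    have h1 := hcompl S
    have h2 := eCount_le_DeltaMax G Sᶜ
    rw [Finset.card_compl, hS] at h2
    rw [hS] at h1
    omega

theorem deltaSeq_add_deltaSeq_of_regular (G : SimpleGraph V) [DecidableRel G.Adj] {d i : ℕ}
    (hd : G.IsRegularOfDegree d) (h1 : 1 ≤ i) (hi : i ≤ Fintype.card V) :
    deltaSeq G i + deltaSeq G (Fintype.card V - i + 1) = d := by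
  obtain ⟨j, rfl⟩ := Nat.exists_eq_add_of_le' h1
  have ha := DeltaMax_sub_add_mul G hd hi
  have hb := DeltaMax_sub_add_mul G hd (Nat.le_of_succ_le hi)
  have hj : Fintype.card V - (j + 1) + 1 = Fintype.card V - j := by omega
  have hj' : Fintype.card V - j - 1 = Fintype.card V - (j + 1) := by omega
  simp only [deltaSeq, hj, hj', Nat.add_sub_cancel]
  zify at ha hb
  linarith

theorem sum_range_deltaSeq (G : SimpleGraph V) [DecidableRel G.Adj] :
    ∑ i ∈ Finset.range (Fintype.card V), deltaSeq G (i + 1) = G.edgeFinset.card := by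
  simp only [deltaSeq, Nat.add_sub_cancel]
  rw [Finset.sum_range_sub (fun i => (DeltaMax G i : ℤ)), DeltaMax_card,
    DeltaMax_of_le_one G (Nat.zero_le _) zero_le_one]
  simp

theorem exists_degree_eq_deltaSeq_card (G : SimpleGraph V) [DecidableRel G.Adj]
    (hn : 1 ≤ Fintype.card V) :
    ∃ w, deltaSeq G (Fintype.card V) = G.degree w ∧ ∀ v, G.degree w ≤ G.degree v := by
  have hdel (v : V) : eCount G {v}ᶜ + G.degree v = G.edgeFinset.card := by
    simpa [eCount_eq_zero_of_card_le_one] using eCount_compl_add_sum_degree G {v}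
  obtain ⟨S, hS, h⟩ := exists_eCount_eq_DeltaMax G (Nat.sub_le (Fintype.card V) 1)
  obtain ⟨w, hw⟩ : ∃ w, Sᶜ = {w} :=
    Finset.card_eq_one.mp (by rw [Finset.card_compl]; omega)
  obtain rfl : S = {w}ᶜ := by rw [← hw, compl_compl]
  have hdw := hdel w
  refine ⟨w, ?_, fun v => ?_⟩
  · rw [deltaSeq, DeltaMax_card]
    omega
  · have hdv := hdel v
    have hle := eCount_le_DeltaMax G {v}ᶜ
    rw [Finset.card_compl, Finset.card_singleton] at hle
    omega

theorem regular_iff_deltaSeq_symmetric (G : SimpleGraph V) [DecidableRel G.Adj]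
    (hconn : G.Connected) (hn : 1 ≤ Fintype.card V) :
    (∃ d, G.IsRegularOfDegree d) ↔
      ∀ i ∈ Finset.Icc 1 (Fintype.card V),
        deltaSeq G i + deltaSeq G (Fintype.card V - i + 1) =
          deltaSeq G 1 + deltaSeq G (Fintype.card V) := by
  constructor
  · rintro ⟨d, hd⟩ i hi
    rw [Finset.mem_Icc] at hi
    have h := deltaSeq_add_deltaSeq_of_regular G hd le_rfl hn
    rw [Nat.sub_add_cancel hn] at h
    rw [deltaSeq_add_deltaSeq_of_regular G hd hi.1 hi.2, h]
  · intro hsymm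
    obtain ⟨w, hw, hmin⟩ := exists_degree_eq_deltaSeq_card G hn
    have hone : deltaSeq G 1 = 0 := by
      simp [deltaSeq, DeltaMax_of_le_one G hn le_rfl,
        DeltaMax_of_le_one G (Nat.zero_le _) zero_le_one]
    have hsum : (2 * G.edgeFinset.card : ℤ) = Fintype.card V * G.degree w := by
      calc (2 * G.edgeFinset.card : ℤ)
          = ∑ i ∈ Finset.range (Fintype.card V),
              (deltaSeq G (i + 1) + deltaSeq G (Fintype.card V - 1 - i + 1)) := by
            rw [Finset.sum_add_distrib,
              Finset.sum_range_reflect (fun i => deltaSeq G (i + 1)), sum_range_deltaSeq,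
              two_mul]
        _ = ∑ i ∈ Finset.range (Fintype.card V), (G.degree w : ℤ) := by
            refine Finset.sum_congr rfl fun i hi => ?_
            rw [Finset.mem_range] at hi
            have h := hsymm (i + 1) (Finset.mem_Icc.mpr ⟨by omega, hi⟩)
            rw [hone, hw, zero_add] at h
            rw [← h, Nat.sub_sub, Nat.add_comm 1 i]
        _ = _ := by simp
    have hdeg : ∑ v : V, G.degree w = ∑ v, G.degree v := by
      rw [G.sum_degrees_eq_twice_card_edges, Finset.sum_const, Finset.card_univ, smul_eq_mul]
      exact_mod_cast hsum.symm
    refine ⟨G.degree w, fun v => ?_⟩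
    exact ((Finset.sum_eq_sum_iff_of_le fun v _ => hmin v).mp hdeg v (Finset.mem_univ v)).symm
end

section
/- Let G be a finite simple undirected connected graph on n ≥ 1 vertices. Then G is regular if and only if its τ-sequence is symmetric, i.e., if and only if τ(i) + τ(n−i+1) = τ(1) + τ(n) for every i ∈ {1, …, n}. -/
variable {V : Type*} [Fintype V] [DecidableEq V]

section VertexCover

variable (G : SimpleGraph V) [DecidableRel G.Adj]

theorem vcCount_add_eCount (S : Finset V) :
    vcCount G S + eCount G S = ∑ v ∈ S, G.degree v := by
  have hdeg : ∀ v, G.degree v = ∑ e ∈ G.edgeFinset, if v ∈ e then 1 else 0 := fun v => by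
    rw [← G.card_incidenceFinset_eq_degree, G.incidenceFinset_eq_filter, Finset.card_filter]
  simp only [hdeg, vcCount, eCount, Finset.card_filter]
  rw [Finset.sum_comm, ← Finset.sum_add_distrib]
  refine Finset.sum_congr rfl fun e he => ?_
  induction e with
  | _ a b =>
    have hab : a ≠ b := (show G.Adj a b by simpa using he).ne
    have hsplit : ∀ v, (if v = a ∨ v = b then 1 else 0) =
        (if v = a then 1 else 0) + (if v = b then 1 else 0 : ℕ) := by
      intro v
      split_ifs <;> simp_all
    simp only [Sym2.mem_iff, hsplit, Finset.sum_add_distrib, Finset.sum_ite_eq']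
    by_cases ha : a ∈ S <;> by_cases hb : b ∈ S <;> simp [ha, hb]

theorem vcCount_add_eCount_compl (S : Finset V) :
    vcCount G S + eCount G Sᶜ = G.edgeFinset.card := by
  rw [← Finset.card_filter_add_card_filter_not (s := G.edgeFinset) (fun e => ∃ v ∈ e, v ∈ S)]
  simp [vcCount, eCount]

theorem eCount_eq_zero {S : Finset V} (hS : S.card ≤ 1) : eCount G S = 0 := by
  rw [eCount, Finset.card_eq_zero, Finset.filter_eq_empty_iff]
  intro e he h
  induction e with
  | _ a b =>
    have hab : a ≠ b := (show G.Adj a b by simpa using he).ne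
    exact hab (Finset.card_le_one.1 hS a (h a (by simp)) b (h b (by simp)))

theorem vcCount_le_card_edgeFinset (S : Finset V) : vcCount G S ≤ G.edgeFinset.card :=
  Finset.card_filter_le _ _

theorem vcCount_le_Tmax (S : Finset V) : vcCount G S ≤ Tmax G S.card := by
  refine le_csSup ⟨G.edgeFinset.card, ?_⟩ ⟨S, rfl, rfl⟩
  rintro _ ⟨S, -, rfl⟩
  exact vcCount_le_card_edgeFinset G S

theorem exists_vcCount_eq_Tmax {i : ℕ} (hi : i ≤ Fintype.card V) :
    ∃ S : Finset V, S.card = i ∧ vcCount G S = Tmax G i := by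
  obtain ⟨S, -, hS⟩ := Finset.exists_subset_card_eq (s := (Finset.univ : Finset V)) hi
  refine Nat.sSup_mem (s := {k | ∃ S : Finset V, S.card = i ∧ vcCount G S = k})
    ⟨_, S, hS, rfl⟩ ⟨G.edgeFinset.card, ?_⟩
  rintro _ ⟨S, -, rfl⟩
  exact vcCount_le_card_edgeFinset G S

theorem Tmax_zero : Tmax G 0 = 0 := by
  obtain ⟨S, hS, h⟩ := exists_vcCount_eq_Tmax G (Nat.zero_le _)
  rw [Finset.card_eq_zero] at hS
  subst hS
  have := vcCount_add_eCount G ∅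
  simp at this
  omega

theorem Tmax_eq_card_edgeFinset {i : ℕ} (hi : i ≤ Fintype.card V) (hi' : Fintype.card V ≤ i + 1) :
    Tmax G i = G.edgeFinset.card := by
  obtain ⟨S, hS, h⟩ := exists_vcCount_eq_Tmax G hi
  have hcompl := vcCount_add_eCount_compl G S
  rw [eCount_eq_zero G (by rw [Finset.card_compl]; omega)] at hcompl
  omega

theorem degree_le_Tmax_one (v : V) : G.degree v ≤ Tmax G 1 := by
  have h := vcCount_add_eCount G {v}
  rw [eCount_eq_zero G (by simp), Finset.sum_singleton] at h
  have := vcCount_le_Tmax G {v}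
  rw [Finset.card_singleton] at this
  omega

variable {G}

theorem SimpleGraph.IsRegularOfDegree.vcCount_add_card_edgeFinset {d : ℕ}
    (hd : G.IsRegularOfDegree d) (S : Finset V) :
    vcCount G S + G.edgeFinset.card = S.card * d + vcCount G Sᶜ := by
  have h₁ := vcCount_add_eCount G S
  have h₂ := vcCount_add_eCount_compl G Sᶜ
  rw [compl_compl] at h₂
  rw [Finset.sum_congr rfl fun v _ => hd v, Finset.sum_const, smul_eq_mul] at h₁
  omega

theorem SimpleGraph.IsRegularOfDegree.Tmax_add_card_edgeFinset {d : ℕ}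
    (hd : G.IsRegularOfDegree d) {i j : ℕ} (hij : i + j = Fintype.card V) :
    Tmax G i + G.edgeFinset.card = i * d + Tmax G j := by
  obtain ⟨S, hS, hSi⟩ := exists_vcCount_eq_Tmax G (show i ≤ Fintype.card V by omega)
  obtain ⟨U, hU, hUj⟩ := exists_vcCount_eq_Tmax G (show j ≤ Fintype.card V by omega)
  have h₁ := hd.vcCount_add_card_edgeFinset S
  have h₂ := hd.vcCount_add_card_edgeFinset Uᶜ
  have hSc : Sᶜ.card = j := by rw [Finset.card_compl]; omega
  have hUc : Uᶜ.card = i := by rw [Finset.card_compl]; omega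
  have h₃ := vcCount_le_Tmax G Sᶜ
  have h₄ := vcCount_le_Tmax G Uᶜ
  rw [compl_compl] at h₂
  rw [hS] at h₁
  rw [hUc] at h₂ h₄
  rw [hSc] at h₃
  omega

theorem SimpleGraph.IsRegularOfDegree.tauSeq_add_tauSeq {d : ℕ} (hd : G.IsRegularOfDegree d)
    {i : ℕ} (hi : 1 ≤ i) (hin : i ≤ Fintype.card V) :
    tauSeq G i + tauSeq G (Fintype.card V - i + 1) = d := by
  obtain ⟨k, rfl⟩ : ∃ k, i = k + 1 := ⟨i - 1, by omega⟩
  have h₁ := hd.Tmax_add_card_edgeFinset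
    (show k + 1 + (Fintype.card V - (k + 1)) = Fintype.card V by omega)
  have h₂ := hd.Tmax_add_card_edgeFinset
    (show k + (Fintype.card V - (k + 1) + 1) = Fintype.card V by omega)
  rw [add_mul, one_mul] at h₁
  simp only [tauSeq, Nat.add_sub_cancel]
  omega

/-- If `τ(i) + τ(n - i + 1)` is constantly `c`, then `c` is the average degree. -/
theorem two_mul_card_edgeFinset_of_tauSeq {c : ℤ}
    (h : ∀ i ∈ Finset.Icc 1 (Fintype.card V),
      tauSeq G i + tauSeq G (Fintype.card V - i + 1) = c) :
    2 * (G.edgeFinset.card : ℤ) = Fintype.card V * c := by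
  have key : ∀ i ≤ Fintype.card V,
      (Tmax G i : ℤ) - Tmax G (Fintype.card V - i) = i * c - Tmax G (Fintype.card V) := by
    intro i
    induction i with
    | zero => simp [Tmax_zero]
    | succ k ih =>
      intro hk
      have hc := h (k + 1) (Finset.mem_Icc.2 ⟨by omega, hk⟩)
      have hk' := ih (by omega)
      rw [show Fintype.card V - k = Fintype.card V - (k + 1) + 1 by omega] at hk'
      simp only [tauSeq, Nat.add_sub_cancel] at hc
      push_cast
      linarith
  have hn := key _ le_rfl
  rw [Nat.sub_self, Tmax_zero, Tmax_eq_card_edgeFinset G le_rfl (by omega)] at hn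
  push_cast at hn
  linarith

end VertexCover

theorem regular_iff_tauSeq_symmetric (G : SimpleGraph V) [DecidableRel G.Adj]
    (hconn : G.Connected) (hn : 1 ≤ Fintype.card V) :
    (∃ d, G.IsRegularOfDegree d) ↔
      ∀ i ∈ Finset.Icc 1 (Fintype.card V),
        tauSeq G i + tauSeq G (Fintype.card V - i + 1) =
          tauSeq G 1 + tauSeq G (Fintype.card V) := by
  constructor
  · rintro ⟨d, hd⟩ i hi
    rw [Finset.mem_Icc] at hi
    have h₁ := hd.tauSeq_add_tauSeq le_rfl hn
    rw [Nat.sub_add_cancel hn] at h₁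
    rw [hd.tauSeq_add_tauSeq hi.1 hi.2, h₁]
  · intro h
    have hm := two_mul_card_edgeFinset_of_tauSeq h
    have hc : tauSeq G 1 + tauSeq G (Fintype.card V) = Tmax G 1 := by
      simp [tauSeq, Tmax_zero, Tmax_eq_card_edgeFinset G le_rfl (Nat.le_succ _),
        Tmax_eq_card_edgeFinset G (Nat.sub_le _ 1) (by omega)]
    rw [hc] at hm
    have hsum : ∑ v, G.degree v = ∑ _v : V, Tmax G 1 := by
      rw [G.sum_degrees_eq_twice_card_edges, Finset.sum_const, smul_eq_mul, Finset.card_univ]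
      exact_mod_cast hm
    exact ⟨Tmax G 1, fun v =>
      (Finset.sum_eq_sum_iff_of_le fun w _ => degree_le_Tmax_one G w).1 hsum v (Finset.mem_univ v)⟩
end

section
/- Let G be a finite simple undirected connected graph on n ≥ 1 vertices. Then G is regular if and only if its υ-sequence is symmetric, i.e., if and only if υ(i) + υ(n−i+1) = υ(1) + υ(n) for every i ∈ {1, …, n}. -/
variable {V : Type*} [Fintype V] [DecidableEq V]

theorem minOver_le {α : Type*} (f : Finset α → ℕ) (S : Finset α) : minOver f S.card ≤ f S :=
  Nat.sInf_le ⟨S, rfl, rfl⟩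

theorem exists_eq_minOver {α : Type*} [Fintype α] (f : Finset α → ℕ) {i : ℕ}
    (hi : i ≤ Fintype.card α) :
    ∃ S : Finset α, S.card = i ∧ f S = minOver f i := by
  obtain ⟨S, -, hS⟩ := Finset.exists_subset_card_eq (s := (Finset.univ : Finset α)) hi
  exact Nat.sInf_mem (s := {k | ∃ S : Finset α, S.card = i ∧ f S = k}) ⟨f S, S, hS, rfl⟩

theorem vcCount_empty (G : SimpleGraph V) [DecidableRel G.Adj] : vcCount G ∅ = 0 := by
  simp [vcCount]

theorem vcCount_singleton (G : SimpleGraph V) [DecidableRel G.Adj] (v : V) :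
    vcCount G {v} = G.degree v := by
  rw [← G.card_incidenceFinset_eq_degree, G.incidenceFinset_eq_filter]
  simp [vcCount]

/-- Passing to the complement changes `vcCount` by the degree sum minus the number of edges. -/
theorem vcCount_add_card_edgeFinset (G : SimpleGraph V) [DecidableRel G.Adj] (S : Finset V) :
    vcCount G S + G.edgeFinset.card = vcCount G Sᶜ + ∑ v ∈ S, G.degree v := by
  have hdeg : ∑ v ∈ S, G.degree v = ∑ e ∈ G.edgeFinset, (S.filter (· ∈ e)).card := by
    simp_rw [← G.card_incidenceFinset_eq_degree, G.incidenceFinset_eq_filter]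
    exact Finset.sum_card_bipartiteAbove_eq_sum_card_bipartiteBelow (fun v e => v ∈ e)
  rw [hdeg, vcCount, vcCount, Finset.card_filter, Finset.card_filter,
    Finset.card_eq_sum_ones G.edgeFinset, ← Finset.sum_add_distrib, ← Finset.sum_add_distrib]
  refine Finset.sum_congr rfl fun e he => ?_
  induction e using Sym2.ind with
  | _ a b =>
    have hab : a ≠ b := G.ne_of_adj (by simpa using he)
    have hfilter : S.filter (· ∈ s(a, b)) = ({a, b} : Finset V).filter (· ∈ S) := by
      ext v
      simp [and_comm]
    rw [hfilter, Finset.filter_insert, Finset.filter_singleton]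
    by_cases ha : a ∈ S <;> by_cases hb : b ∈ S <;> simp [ha, hb, hab]

theorem UpsilonMin_zero (G : SimpleGraph V) [DecidableRel G.Adj] : UpsilonMin G 0 = 0 := by
  simpa [UpsilonMin, vcCount_empty] using minOver_le (vcCount G) ∅

theorem UpsilonMin_one_le_degree (G : SimpleGraph V) [DecidableRel G.Adj] (v : V) :
    UpsilonMin G 1 ≤ G.degree v := by
  simpa [UpsilonMin, vcCount_singleton] using minOver_le (vcCount G) {v}

theorem UpsilonMin_card (G : SimpleGraph V) [DecidableRel G.Adj] :
    UpsilonMin G (Fintype.card V) = G.edgeFinset.card := by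
  obtain ⟨S, hS, hmin⟩ := exists_eq_minOver (vcCount G) le_rfl
  rw [Finset.card_eq_iff_eq_univ] at hS
  subst hS
  have h := vcCount_add_card_edgeFinset G Finset.univ
  rw [Finset.compl_univ, vcCount_empty, G.sum_degrees_eq_twice_card_edges] at h
  rw [UpsilonMin, ← hmin]
  omega

theorem UpsilonMin_card_sub_one (G : SimpleGraph V) [DecidableRel G.Adj]
    (hn : 1 ≤ Fintype.card V) : UpsilonMin G (Fintype.card V - 1) = G.edgeFinset.card := by
  obtain ⟨S, hS, hmin⟩ := exists_eq_minOver (vcCount G) (Nat.sub_le (Fintype.card V) 1)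
  have hc : Sᶜ.card = 1 := by
    rw [Finset.card_compl]
    omega
  obtain ⟨v, hv⟩ := Finset.card_eq_one.mp hc
  have h := vcCount_add_card_edgeFinset G {v}
  rw [← hv, compl_compl, hv, vcCount_singleton, Finset.sum_singleton] at h
  rw [UpsilonMin, ← hmin]
  omega

theorem UpsilonMin_add_card_edgeFinset_le {G : SimpleGraph V} [DecidableRel G.Adj] {d : ℕ}
    (hd : G.IsRegularOfDegree d) {i : ℕ} (hi : i ≤ Fintype.card V) :
    UpsilonMin G i + G.edgeFinset.card ≤ UpsilonMin G (Fintype.card V - i) + i * d := by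
  obtain ⟨S, hS, hmin⟩ := exists_eq_minOver (vcCount G) (Nat.sub_le (Fintype.card V) i)
  have hc : Sᶜ.card = i := by
    rw [Finset.card_compl]
    omega
  have h := vcCount_add_card_edgeFinset G Sᶜ
  rw [compl_compl, Finset.sum_congr rfl fun v _ => hd.degree_eq v, Finset.sum_const, hc,
    smul_eq_mul, hmin] at h
  have hle := minOver_le (vcCount G) Sᶜ
  rw [hc] at hle
  rw [UpsilonMin, UpsilonMin]
  omega

theorem UpsilonMin_add_card_edgeFinset {G : SimpleGraph V} [DecidableRel G.Adj] {d : ℕ}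
    (hd : G.IsRegularOfDegree d) {i : ℕ} (hi : i ≤ Fintype.card V) :
    UpsilonMin G i + G.edgeFinset.card = UpsilonMin G (Fintype.card V - i) + i * d := by
  refine (UpsilonMin_add_card_edgeFinset_le hd hi).antisymm ?_
  have h := UpsilonMin_add_card_edgeFinset_le hd (Nat.sub_le (Fintype.card V) i)
  have hm : 2 * G.edgeFinset.card = Fintype.card V * d := by
    rw [← G.sum_degrees_eq_twice_card_edges, Finset.sum_congr rfl fun v _ => hd.degree_eq v]
    simp
  rw [Nat.sub_sub_self hi, Nat.sub_mul] at h
  have := Nat.mul_le_mul_right d hi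
  omega

theorem upsilonSeq_add_reflect {G : SimpleGraph V} [DecidableRel G.Adj] {d : ℕ}
    (hd : G.IsRegularOfDegree d) {i : ℕ} (h1 : 1 ≤ i) (hi : i ≤ Fintype.card V) :
    upsilonSeq G i + upsilonSeq G (Fintype.card V - i + 1) = d := by
  obtain ⟨j, rfl⟩ := Nat.exists_eq_add_of_le' h1
  have hj := UpsilonMin_add_card_edgeFinset hd (Nat.le_of_succ_le hi)
  have hj' := UpsilonMin_add_card_edgeFinset hd hi
  have hsub : Fintype.card V - (j + 1) + 1 = Fintype.card V - j := by omega
  rw [add_one_mul] at hj'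
  simp only [upsilonSeq, hsub, Nat.add_sub_cancel, Nat.sub_sub]
  omega

theorem sum_upsilonSeq (G : SimpleGraph V) [DecidableRel G.Adj] :
    ∑ i ∈ Finset.range (Fintype.card V), upsilonSeq G (i + 1) = G.edgeFinset.card := by
  simp only [upsilonSeq, Nat.add_sub_cancel]
  rw [Finset.sum_range_sub (fun i => (UpsilonMin G i : ℤ)), UpsilonMin_card, UpsilonMin_zero]
  simp

theorem regular_iff_upsilonSeq_symmetric (G : SimpleGraph V) [DecidableRel G.Adj]
    (hconn : G.Connected) (hn : 1 ≤ Fintype.card V) :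
    (∃ d, G.IsRegularOfDegree d) ↔
      ∀ i ∈ Finset.Icc 1 (Fintype.card V),
        upsilonSeq G i + upsilonSeq G (Fintype.card V - i + 1) =
          upsilonSeq G 1 + upsilonSeq G (Fintype.card V) := by
  constructor
  · rintro ⟨d, hd⟩ i hi
    rw [Finset.mem_Icc] at hi
    rw [upsilonSeq_add_reflect hd hi.1 hi.2, ← upsilonSeq_add_reflect hd le_rfl hn,
      Nat.sub_add_cancel hn]
  · intro h
    have hends : upsilonSeq G 1 + upsilonSeq G (Fintype.card V) = UpsilonMin G 1 := by
      simp [upsilonSeq, UpsilonMin_zero, UpsilonMin_card, UpsilonMin_card_sub_one G hn]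
    have hreflect : ∑ i ∈ Finset.range (Fintype.card V),
        upsilonSeq G (Fintype.card V - (i + 1) + 1) = G.edgeFinset.card := by
      rw [← sum_upsilonSeq, ← Finset.sum_range_reflect fun i => upsilonSeq G (i + 1)]
      exact Finset.sum_congr rfl fun i _ => by rw [Nat.sub_sub, Nat.add_comm 1 i]
    have hsum : (G.edgeFinset.card : ℤ) + G.edgeFinset.card =
        Fintype.card V * UpsilonMin G 1 := by
      nth_rw 1 [← sum_upsilonSeq, ← hreflect]
      rw [← Finset.sum_add_distrib, Finset.sum_congr rfl fun i hi => (h (i + 1)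
        (Finset.mem_Icc.mpr ⟨Nat.le_add_left 1 i, Finset.mem_range.mp hi⟩)).trans hends]
      simp
    have hdegrees : ∑ _v : V, UpsilonMin G 1 = ∑ v, G.degree v := by
      rw [G.sum_degrees_eq_twice_card_edges, Finset.sum_const, Finset.card_univ, smul_eq_mul]
      zify
      rw [← hsum, two_mul]
    exact ⟨UpsilonMin G 1, fun v => ((Finset.sum_eq_sum_iff_of_le fun v _ =>
      UpsilonMin_one_le_degree G v).mp hdegrees v (Finset.mem_univ v)).symm⟩
end

section
/- Let G be a finite simple undirected d-regular graph on n ≥ 1 vertices. Then δ(i) + δ(n−i+1) = d for every i ∈ {1, …, n}. -/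
variable {V : Type*} [Fintype V] [DecidableEq V]

/-- In a `d`-regular graph, double counting the incidences between edges and the vertices of `S`
relates the numbers of edges induced by `S` and by its complement. -/
lemma eCount_add_card_edgeFinset (G : SimpleGraph V) [DecidableRel G.Adj] {d : ℕ}
    (hreg : G.IsRegularOfDegree d) (S : Finset V) :
    eCount G S + G.edgeFinset.card = eCount G Sᶜ + d * S.card := by
  have hdeg : d * S.card = ∑ e ∈ G.edgeFinset, (S.filter fun v => v ∈ e).card := by
    calc d * S.card = ∑ v ∈ S, (G.edgeFinset.filter fun e => v ∈ e).card := by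
          simp_rw [← G.incidenceFinset_eq_filter, G.card_incidenceFinset_eq_degree, hreg.degree_eq]
          simp [mul_comm]
      _ = _ := Finset.sum_card_bipartiteAbove_eq_sum_card_bipartiteBelow (fun v e => v ∈ e)
  rw [hdeg, eCount, eCount, Finset.card_filter, Finset.card_filter, Finset.card_eq_sum_ones,
    ← Finset.sum_add_distrib, ← Finset.sum_add_distrib]
  refine Finset.sum_congr rfl fun e he => ?_
  induction e with
  | _ a b =>
    have hab : a ≠ b := (show G.Adj a b by simpa using he).ne
    have hcard : (S.filter fun v => v ∈ s(a, b)).card =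
        (if a ∈ S then 1 else 0) + if b ∈ S then 1 else 0 := by
      have hfilter : (S.filter fun v => v ∈ s(a, b)) = ({a, b} : Finset V).filter (· ∈ S) := by
        ext v
        simp [and_comm]
      rw [hfilter, Finset.card_filter, Finset.sum_pair hab]
    rw [hcard]
    by_cases ha : a ∈ S <;> by_cases hb : b ∈ S <;> simp [ha, hb]

/-- `maxOver f i` is a genuine maximum whenever some vertex set has cardinality `i`. -/
lemma isGreatest_maxOver {α : Type*} [Fintype α] (f : Finset α → ℕ) {i : ℕ}
    (hi : i ≤ Fintype.card α) :
    IsGreatest {k | ∃ S : Finset α, S.card = i ∧ f S = k} (maxOver f i) := by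
  have hfin : {k | ∃ S : Finset α, S.card = i ∧ f S = k}.Finite :=
    (Set.finite_range f).subset (by rintro _ ⟨S, -, rfl⟩; exact ⟨S, rfl⟩)
  obtain ⟨S, -, hS⟩ := Finset.exists_subset_card_eq (s := (Finset.univ : Finset α)) hi
  have hne : {k | ∃ S : Finset α, S.card = i ∧ f S = k}.Nonempty := ⟨f S, S, hS, rfl⟩
  exact ⟨Nat.sSup_mem hne hfin.bddAbove, fun _ hk => le_csSup hfin.bddAbove hk⟩

/-- The reflection formula for `Δ` in a `d`-regular graph. -/
lemma DeltaMax_add_card_edgeFinset (G : SimpleGraph V) [DecidableRel G.Adj] {d : ℕ}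
    (hreg : G.IsRegularOfDegree d) {i : ℕ} (hi : i ≤ Fintype.card V) :
    DeltaMax G i + G.edgeFinset.card = DeltaMax G (Fintype.card V - i) + d * i := by
  obtain ⟨⟨S, hSi, hS⟩, hmax⟩ := isGreatest_maxOver (eCount G) hi
  obtain ⟨⟨T, hTi, hT⟩, hmax'⟩ := isGreatest_maxOver (eCount G) (Nat.sub_le (Fintype.card V) i)
  have hTc : Tᶜ.card = i := by rw [Finset.card_compl]; omega
  have hle := hmax' ⟨Sᶜ, by rw [Finset.card_compl, hSi], rfl⟩
  have hge := hmax ⟨Tᶜ, hTc, rfl⟩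
  have keyS := eCount_add_card_edgeFinset G hreg S
  have keyT := eCount_add_card_edgeFinset G hreg Tᶜ
  rw [compl_compl, hTc] at keyT
  rw [hSi] at keyS
  unfold DeltaMax
  omega

theorem deltaSeq_add_symm_eq_degree (G : SimpleGraph V) [DecidableRel G.Adj]
    (hn : 1 ≤ Fintype.card V) (d : ℕ) (hreg : G.IsRegularOfDegree d) :
    ∀ i ∈ Finset.Icc 1 (Fintype.card V),
      deltaSeq G i + deltaSeq G (Fintype.card V - i + 1) = (d : ℤ) := by
  intro i hi
  obtain ⟨h1, h2⟩ := Finset.mem_Icc.mp hi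
  have hi₀ := DeltaMax_add_card_edgeFinset G hreg h2
  have hi₁ := DeltaMax_add_card_edgeFinset G hreg ((Nat.sub_le i 1).trans h2)
  obtain ⟨j, rfl⟩ := Nat.exists_eq_add_of_le' h1
  have hj : Fintype.card V - (j + 1) + 1 = Fintype.card V - j := by omega
  rw [deltaSeq, deltaSeq, Nat.add_sub_cancel, hj]
  rw [Nat.add_sub_cancel] at hi₁
  have hj' : Fintype.card V - j - 1 = Fintype.card V - (j + 1) := by omega
  rw [hj']
  zify at hi₀ hi₁
  linarith
end
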